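/- Interface rapidity equation: assume the Rankine–Hugoniot relation holds, W_I ≠ Z, and the positivity conditions μ_I + p_I > 0, μ_II + p_II > 0, μ_I + p_II > 0, μ_II + p_I > 0. Then (μ_I − p_I − μ_II + p_II) · sinh²(Z − W_I) = (p_I − p_II)(μ_II + p_I) / ((μ_I + p_I)(1 + |u∥_I|²)). -/

import Mathlib

open Real

/-- Squared Euclidean norm of a vector. -/
noncomputable def nsq {n : ℕ} (w : Fin n → ℝ) : ℝ := ∑ j, (w j) ^ 2

/-- Minkowski bilinear form on `ℝ^{d+1}`: `η(x,y) = -x₀y₀ + ∑_{j=1}^d xⱼyⱼ`. -/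
noncomputable def eta {d : ℕ} (x y : Fin (d + 1) → ℝ) : ℝ :=
  -(x 0 * y 0) + ∑ j : Fin d, x j.succ * y j.succ

/-- Unit spacelike normal `V = (sinh Z, cosh Z, 0, …, 0)` to the interface. -/
noncomputable def normalV (d : ℕ) (Z : ℝ) : Fin (d + 1) → ℝ := fun i =>
  if i.val = 0 then Real.sinh Z else if i.val = 1 then Real.cosh Z else 0

/-- Unit timelike fluid velocity determined by the perpendicular rapidity `W` and
the parallel velocity `w ∈ ℝ^{d-1}`. -/
noncomputable def vel (d : ℕ) (W : ℝ) (w : Fin (d - 1) → ℝ) : Fin (d + 1) → ℝ := fun i =>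
  if i.val = 0 then Real.sqrt (1 + nsq w) * Real.cosh W
  else if i.val = 1 then Real.sqrt (1 + nsq w) * Real.sinh W
  else if h : i.val - 2 < d - 1 then w ⟨i.val - 2, h⟩ else 0

/-- The Rankine–Hugoniot relation
`(μ_II + p_II) η(u_II,V) u_II − (μ_I + p_I) η(u_I,V) u_I + (p_II − p_I) V = 0`. -/
def RH (d : ℕ) (μI pI μII pII : ℝ) (uI uII V : Fin (d + 1) → ℝ) : Prop :=
  ∀ i, (μII + pII) * eta uII V * uII i - (μI + pI) * eta uI V * uI i + (pII - pI) * V i = 0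

lemma eta_comm {d : ℕ} (x y : Fin (d + 1) → ℝ) : eta x y = eta y x := by
  simp only [eta, mul_comm]

lemma eta_linear_left {d : ℕ} (a b : ℝ) (x y z : Fin (d + 1) → ℝ) :
    eta (fun i => a * x i + b * y i) z = a * eta x z + b * eta y z := by
  simp only [eta, add_mul, Finset.sum_add_distrib, mul_add, Finset.mul_sum, mul_assoc]
  ring

lemma eta_linear_self {d : ℕ} (a b : ℝ) (x y : Fin (d + 1) → ℝ) :
    eta (fun i => a * x i + b * y i) (fun i => a * x i + b * y i)
      = a ^ 2 * eta x x + 2 * a * b * eta x y + b ^ 2 * eta y y := by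
  rw [eta_linear_left, eta_comm x, eta_comm y, eta_linear_left, eta_linear_left, eta_comm y x]
  ring

lemma one_add_nsq_pos {n : ℕ} (w : Fin n → ℝ) : 0 < 1 + nsq w := by
  have : 0 ≤ nsq w := Finset.sum_nonneg fun j _ => sq_nonneg (w j)
  linarith

lemma eta_normalV_self {d : ℕ} (hd : 1 ≤ d) (Z : ℝ) :
    eta (normalV d Z) (normalV d Z) = 1 := by
  obtain ⟨m, rfl⟩ := Nat.exists_eq_add_of_le' hd
  simp only [eta, normalV, Fin.sum_univ_succ]
  simp
  linarith [Real.cosh_sq Z]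

lemma eta_vel_normalV {d : ℕ} (hd : 1 ≤ d) (W Z : ℝ) (w : Fin (d - 1) → ℝ) :
    eta (vel d W w) (normalV d Z) = √(1 + nsq w) * Real.sinh (W - Z) := by
  obtain ⟨m, rfl⟩ := Nat.exists_eq_add_of_le' hd
  simp only [eta, normalV, vel, Fin.sum_univ_succ, Real.sinh_sub]
  simp
  ring

lemma eta_vel_self {d : ℕ} (hd : 1 ≤ d) (W : ℝ) (w : Fin (d - 1) → ℝ) :
    eta (vel d W w) (vel d W w) = -1 := by
  obtain ⟨m, rfl⟩ := Nat.exists_eq_add_of_le' hd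
  have hsq := Real.sq_sqrt (one_add_nsq_pos w).le
  have hpar : ∑ j : Fin m, vel (m + 1) W w j.succ.succ * vel (m + 1) W w j.succ.succ = nsq w := by
    refine Finset.sum_congr rfl fun j _ => ?_
    simp [vel, sq]
  have h0 : vel (m + 1) W w 0 = √(1 + nsq w) * Real.cosh W := by simp [vel]
  have h1 : vel (m + 1) W w (Fin.succ 0) = √(1 + nsq w) * Real.sinh W := by simp [vel]
  rw [eta, Fin.sum_univ_succ, hpar, h0, h1]
  linear_combination (-√(1 + nsq w) ^ 2) * Real.cosh_sq W - hsq

/-- The Rankine–Hugoniot relation for unit timelike velocities and a unit spacelike normal,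
with the velocity of the second phase eliminated. -/
lemma RH.normal_flux_eq {d : ℕ} {μI pI μII pII : ℝ} {uI uII V : Fin (d + 1) → ℝ}
    (hRH : RH d μI pI μII pII uI uII V) (huI : eta uI uI = -1) (huII : eta uII uII = -1)
    (hV : eta V V = 1) :
    (μI - pI - μII + pII) * ((μI + pI) * eta uI V ^ 2) = (pI - pII) * (μII + pI) := by
  have hT : (fun i => ((μII + pII) * eta uII V) * uII i + pII * V i)
      = fun i => ((μI + pI) * eta uI V) * uI i + pI * V i :=
    funext fun i => by linear_combination hRH i
  have hN := congrArg (fun T => eta T V) hT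
  have hS := congrArg (fun T => eta T T) hT
  simp only [eta_linear_left, hV] at hN
  simp only [eta_linear_self, huI, huII, hV] at hS
  linear_combination hS - (pII - μII) * hN

/-- Interface rapidity equation. -/
theorem interface_rapidity_equation (d : ℕ) (hd : 2 ≤ d) (Z μI μII pI pII WI WII : ℝ)
    (wI wII : Fin (d - 1) → ℝ) (hμI : 0 ≤ μI) (hμII : 0 ≤ μII)
    (hW : WI ≠ Z)
    (h1 : 0 < μI + pI) (h2 : 0 < μII + pII) (h3 : 0 < μI + pII) (h4 : 0 < μII + pI)
    (hRH : RH d μI pI μII pII (vel d WI wI) (vel d WII wII) (normalV d Z)) :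
    (μI - pI - μII + pII) * Real.sinh (Z - WI) ^ 2
      = (pI - pII) * (μII + pI) / ((μI + pI) * (1 + nsq wI)) := by
  have hd1 : 1 ≤ d := by omega
  have hflux := hRH.normal_flux_eq (eta_vel_self hd1 WI wI) (eta_vel_self hd1 WII wII)
    (eta_normalV_self hd1 Z)
  have hpos := one_add_nsq_pos wI
  rw [eta_vel_normalV hd1, mul_pow, Real.sq_sqrt hpos.le, ← neg_sub Z WI, Real.sinh_neg,
    neg_sq] at hflux
  rw [eq_div_iff (mul_pos h1 hpos).ne']
  linear_combination hflux
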